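/- Let n ≥ 2 and let f : ℝ³ → ℝ be a smooth function (ContDiff ℝ ⊤) that is polyharmonic of order n − 1, i.e. Δⁿ⁻¹f = 0 on ℝ³. Then the function g(x) = x₁ · f(x) is polyharmonic of order n, i.e. Δⁿg = 0 on ℝ³. -/

import Mathlib

/-- Partial derivative along the `i`-th coordinate direction in `ℝ³`. -/
noncomputable def pd (i : Fin 3) (f : (Fin 3 → ℝ) → ℝ) : (Fin 3 → ℝ) → ℝ :=
  fun x => fderiv ℝ f x (Pi.single i 1)

/-- Scalar Laplacian `Δf = ∂₁²f + ∂₂²f + ∂₃²f`. -/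
noncomputable def lap (f : (Fin 3 → ℝ) → ℝ) : (Fin 3 → ℝ) → ℝ :=
  fun x => pd 0 (pd 0 f) x + pd 1 (pd 1 f) x + pd 2 (pd 2 f) x

/-- Divergence of a vector field given by components. -/
noncomputable def div3 (F1 F2 F3 : (Fin 3 → ℝ) → ℝ) : (Fin 3 → ℝ) → ℝ :=
  fun x => pd 0 F1 x + pd 1 F2 x + pd 2 F3 x

/-- First component of the curl. -/
noncomputable def curl1 (F1 F2 F3 : (Fin 3 → ℝ) → ℝ) : (Fin 3 → ℝ) → ℝ :=
  fun x => pd 1 F3 x - pd 2 F2 x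

/-- Second component of the curl. -/
noncomputable def curl2 (F1 F2 F3 : (Fin 3 → ℝ) → ℝ) : (Fin 3 → ℝ) → ℝ :=
  fun x => pd 2 F1 x - pd 0 F3 x

/-- Third component of the curl. -/
noncomputable def curl3 (F1 F2 F3 : (Fin 3 → ℝ) → ℝ) : (Fin 3 → ℝ) → ℝ :=
  fun x => pd 0 F2 x - pd 1 F1 x

theorem ContDiff.pd {f : (Fin 3 → ℝ) → ℝ} (hf : ContDiff ℝ (⊤ : ℕ∞) f) (i : Fin 3) :
    ContDiff ℝ (⊤ : ℕ∞) (pd i f) :=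
  (hf.fderiv_right (m := (⊤ : ℕ∞)) le_rfl).clm_apply contDiff_const

theorem ContDiff.lap {f : (Fin 3 → ℝ) → ℝ} (hf : ContDiff ℝ (⊤ : ℕ∞) f) :
    ContDiff ℝ (⊤ : ℕ∞) (lap f) :=
  (((hf.pd 0).pd 0).add ((hf.pd 1).pd 1)).add ((hf.pd 2).pd 2)

theorem ContDiff.lap_iterate {f : (Fin 3 → ℝ) → ℝ} (hf : ContDiff ℝ (⊤ : ℕ∞) f) (k : ℕ) :
    ContDiff ℝ (⊤ : ℕ∞) (_root_.lap^[k] f) := by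
  induction k with
  | zero => exact hf
  | succ k ih =>
    rw [Function.iterate_succ_apply']
    exact ih.lap

theorem pd_add {f g : (Fin 3 → ℝ) → ℝ} (hf : Differentiable ℝ f) (hg : Differentiable ℝ g)
    (i : Fin 3) : pd i (f + g) = pd i f + pd i g := by
  ext x
  simp [pd, fderiv_add (hf x) (hg x)]

theorem pd_const_smul {f : (Fin 3 → ℝ) → ℝ} (hf : Differentiable ℝ f) (c : ℝ) (i : Fin 3) :
    pd i (c • f) = c • pd i f := by
  ext x
  simp [pd, fderiv_const_smul (hf x) c]

theorem pd_zero (i : Fin 3) : pd i 0 = 0 := by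
  ext x
  simp [pd]

theorem pd_coord_mul {f : (Fin 3 → ℝ) → ℝ} (hf : Differentiable ℝ f) (i j : Fin 3) :
    pd i (fun y => y j * f y) =
      (fun y => y j * pd i f y) + (Pi.single i 1 : Fin 3 → ℝ) j • f := by
  ext x
  have h : HasFDerivAt (fun y : Fin 3 → ℝ => y j)
      (ContinuousLinearMap.proj j : (Fin 3 → ℝ) →L[ℝ] ℝ) x := hasFDerivAt_apply j x
  have h' : fderiv ℝ (fun y => y j * f y) x = _ := (h.mul (hf x).hasFDerivAt).fderiv
  simp only [pd, h']
  simp [mul_comm]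

theorem pd_comm {f : (Fin 3 → ℝ) → ℝ} (hf : ContDiff ℝ (⊤ : ℕ∞) f) (i j : Fin 3) :
    pd i (pd j f) = pd j (pd i f) := by
  have hd : Differentiable ℝ (fderiv ℝ f) :=
    (hf.fderiv_right (m := (⊤ : ℕ∞)) le_rfl).differentiable (by simp)
  have key (i j : Fin 3) (x : Fin 3 → ℝ) : pd i (pd j f) x =
      fderiv ℝ (fderiv ℝ f) x (Pi.single i 1) (Pi.single j 1) := by
    unfold pd
    rw [fderiv_clm_apply (hd x) (differentiableAt_const _)]
    simp
  ext x
  rw [key, key]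
  exact (hf.contDiffAt.isSymmSndFDerivAt (by simpa using WithTop.coe_le_coe.2 (le_top : (2 : ℕ∞) ≤ ⊤))).eq _ _

theorem lap_eq (f : (Fin 3 → ℝ) → ℝ) :
    lap f = pd 0 (pd 0 f) + pd 1 (pd 1 f) + pd 2 (pd 2 f) := rfl

theorem lap_zero : lap 0 = 0 := by
  simp [lap_eq, pd_zero]

theorem lap_add {f g : (Fin 3 → ℝ) → ℝ} (hf : ContDiff ℝ (⊤ : ℕ∞) f)
    (hg : ContDiff ℝ (⊤ : ℕ∞) g) : lap (f + g) = lap f + lap g := by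
  have key (i : Fin 3) : pd i (pd i (f + g)) = pd i (pd i f) + pd i (pd i g) := by
    rw [pd_add (hf.differentiable (by simp)) (hg.differentiable (by simp)),
      pd_add ((hf.pd i).differentiable (by simp)) ((hg.pd i).differentiable (by simp))]
  simp only [lap_eq, key]
  abel

theorem lap_const_smul {f : (Fin 3 → ℝ) → ℝ} (hf : ContDiff ℝ (⊤ : ℕ∞) f) (c : ℝ) :
    lap (c • f) = c • lap f := by
  have key (i : Fin 3) : pd i (pd i (c • f)) = c • pd i (pd i f) := by
    rw [pd_const_smul (hf.differentiable (by simp)),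
      pd_const_smul ((hf.pd i).differentiable (by simp))]
  simp only [lap_eq, key, smul_add]

theorem lap_pd {f : (Fin 3 → ℝ) → ℝ} (hf : ContDiff ℝ (⊤ : ℕ∞) f) (i : Fin 3) :
    lap (pd i f) = pd i (lap f) := by
  have key (j : Fin 3) : pd j (pd j (pd i f)) = pd i (pd j (pd j f)) := by
    rw [pd_comm hf j i, pd_comm (hf.pd j) j i]
  have hd (j : Fin 3) : ContDiff ℝ (⊤ : ℕ∞) (pd j (pd j f)) := (hf.pd j).pd j
  have hd' : ContDiff ℝ (⊤ : ℕ∞) (pd 0 (pd 0 f) + pd 1 (pd 1 f)) := (hd 0).add (hd 1)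
  rw [lap_eq f, pd_add (hd'.differentiable (by simp)) ((hd 2).differentiable (by simp)),
    pd_add ((hd 0).differentiable (by simp)) ((hd 1).differentiable (by simp)), lap_eq,
    key, key, key]

theorem ContDiff.coord_mul {f : (Fin 3 → ℝ) → ℝ} (hf : ContDiff ℝ (⊤ : ℕ∞) f) (j : Fin 3) :
    ContDiff ℝ (⊤ : ℕ∞) (fun y => y j * f y) :=
  (contDiff_apply ℝ ℝ j).mul hf

theorem lap_coord_mul {f : (Fin 3 → ℝ) → ℝ} (hf : ContDiff ℝ (⊤ : ℕ∞) f) (j : Fin 3) :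
    lap (fun y => y j * f y) = (fun y => y j * lap f y) + (2 : ℝ) • pd j f := by
  have key (i : Fin 3) : pd i (pd i (fun y => y j * f y)) =
      (fun y => y j * pd i (pd i f) y) + (2 * (Pi.single i 1 : Fin 3 → ℝ) j) • pd i f := by
    have hs : ContDiff ℝ (⊤ : ℕ∞) ((Pi.single i 1 : Fin 3 → ℝ) j • f) :=
      hf.const_smul ((Pi.single i 1 : Fin 3 → ℝ) j)
    rw [pd_coord_mul (hf.differentiable (by simp)),
      pd_add (((hf.pd i).coord_mul j).differentiable (by simp)) (hs.differentiable (by simp)),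
      pd_coord_mul ((hf.pd i).differentiable (by simp)),
      pd_const_smul (hf.differentiable (by simp))]
    module
  ext x
  simp only [lap_eq, key]
  fin_cases j <;> simp <;> ring

/-- The commutator of an iterated Laplacian with multiplication by a coordinate. -/
theorem lap_iterate_coord_mul {f : (Fin 3 → ℝ) → ℝ} (hf : ContDiff ℝ (⊤ : ℕ∞) f) (j : Fin 3)
    (k : ℕ) : lap^[k + 1] (fun y => y j * f y) =
      (fun y => y j * lap^[k + 1] f y) + (2 * (k + 1) : ℝ) • pd j (lap^[k] f) := by
  induction k with
  | zero => simpa using lap_coord_mul hf j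
  | succ k ih =>
    have hk := hf.lap_iterate k
    have hk' := hf.lap_iterate (k + 1)
    have hs : ContDiff ℝ (⊤ : ℕ∞) ((2 * (k + 1) : ℝ) • pd j (lap^[k] f)) :=
      (hk.pd j).const_smul (2 * (k + 1) : ℝ)
    rw [Function.iterate_succ_apply', ih, lap_add (hk'.coord_mul j) hs,
      lap_coord_mul hk', lap_const_smul (hk.pd j), lap_pd hk,
      ← Function.iterate_succ_apply' lap k f, ← Function.iterate_succ_apply' lap (k + 1) f]
    push_cast
    module

theorem polyharmonic_x_mul (f : (Fin 3 → ℝ) → ℝ) (hf : ContDiff ℝ (⊤ : ℕ∞) f)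
    (n : ℕ) (hn : 2 ≤ n) (hpoly : ∀ x : Fin 3 → ℝ, lap^[n - 1] f x = 0) :
    ∀ x : Fin 3 → ℝ, lap^[n] (fun y => y 0 * f y) x = 0 := by
  obtain ⟨m, rfl⟩ : ∃ m, n = m + 1 := ⟨n - 1, by omega⟩
  have h0 : lap^[m] f = 0 := funext hpoly
  intro x
  rw [lap_iterate_coord_mul hf, Function.iterate_succ_apply', h0, lap_zero, pd_zero]
  simp
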